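/- For every z ∈ (0, 1], the strict inequality −B3·(1−B4)·(B1−B3)·z^{B3−1} − B4·(B3−1)·(B1−B4)·z^{B4−1} > 0 holds; in particular, taking z = 1, one has −B3·(1−B4)·(B1−B3) − B4·(B3−1)·(B1−B4) > 0. -/

import Mathlib

/-- The larger root of `δ x² - (r - m + δ) x - m`, with its equation rearranged around `x = 1`. -/
lemma one_lt_larger_root {r m δ B : ℝ} (hr : 0 < r) (hm : 0 < m) (hδ : 0 < δ)
    (hB : B = (1/(2*δ)) * ((r - m + δ) + Real.sqrt ((r - m + δ)^2 + 4*δ*m))) :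
    1 < B ∧ (B - 1) * (δ * B + m) = r * B := by
  have hδm : 0 < δ * m := mul_pos hδ hm
  have hsq := Real.sq_sqrt (show 0 ≤ (r - m + δ)^2 + 4*δ*m by positivity)
  have habs : |r - m + δ| < Real.sqrt ((r - m + δ)^2 + 4*δ*m) := by
    apply Real.lt_sqrt_of_sq_lt
    rw [sq_abs]
    linarith
  set S := Real.sqrt ((r - m + δ)^2 + 4*δ*m)
  have hS : S = 2 * δ * B - (r - m + δ) := by
    rw [hB]
    field_simp
    ring
  have hpos : 0 < B := by
    rw [hB]
    have := neg_abs_le (r - m + δ)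
    exact mul_pos (by positivity) (by linarith)
  have heq : (B - 1) * (δ * B + m) = r * B := by
    rw [hS] at hsq
    have : 4 * δ * ((B - 1) * (δ * B + m)) = 4 * δ * (r * B) := by linear_combination hsq
    exact mul_left_cancel₀ (by positivity) this
  refine ⟨?_, heq⟩
  have : 0 < (B - 1) * (δ * B + m) := heq ▸ mul_pos hr hpos
  linarith [pos_of_mul_pos_left this (by positivity)]


/-- For every z ∈ (0,1], −B3(1−B4)(B1−B3)z^{B3−1} − B4(B3−1)(B1−B4)z^{B4−1} > 0;
in particular at z = 1. -/
theorem stmt_10 (r μ σ la ρ c L : ℝ)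
    (hr : 0 < r) (hμ : r < μ) (hσ : 0 < σ) (hla : 0 < la) (hρ : 0 < ρ)
    (hc : 0 < c) (hL : 0 < L)
    (δ B1 B3 B4 : ℝ)
    (hδ : δ = (1/2) * ((μ - r)/σ)^2)
    (hB1 : B1 = (1/(2*δ)) * ((r - la + δ) + Real.sqrt ((r - la + δ)^2 + 4*δ*la)))
    (hB3 : B3 = (1/(2*δ)) * ((r - la - ρ + δ) + Real.sqrt ((r - la - ρ + δ)^2 + 4*δ*(la + ρ))))
    (hB4 : B4 = (1/(2*δ)) * ((r - la - ρ + δ) - Real.sqrt ((r - la - ρ + δ)^2 + 4*δ*(la + ρ)))) :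
    (∀ z ∈ Set.Ioc (0:ℝ) 1,
        -B3*(1 - B4)*(B1 - B3) * z ^ (B3 - 1) - B4*(B3 - 1)*(B1 - B4) * z ^ (B4 - 1) > 0) ∧
      -B3*(1 - B4)*(B1 - B3) - B4*(B3 - 1)*(B1 - B4) > 0 := by
  have hδpos : 0 < δ := by
    have : 0 < (μ - r) / σ := div_pos (by linarith) hσ
    rw [hδ]
    positivity
  obtain ⟨hB1_one, hB1_eq⟩ := one_lt_larger_root hr hla hδpos hB1
  rw [sub_sub] at hB3 hB4
  have hm : 0 < la + ρ := by linarith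
  obtain ⟨hB3_one, hB3_eq⟩ := one_lt_larger_root hr hm hδpos hB3
  have hsum : δ * (B3 + B4) = r - (la + ρ) + δ := by
    rw [hB3, hB4]
    field_simp
    ring
  have hprod : δ * (B3 * B4) = -(la + ρ) := by
    linear_combination B3 * hsum - hB3_eq
  have hB4_neg : B4 < 0 := by
    have : 0 < δ * B3 := mul_pos hδpos (by linarith)
    nlinarith
  have hB3_lt : B3 < B1 := by
    by_contra! h
    nlinarith [mul_pos hρ (sub_pos.2 hB1_one), mul_nonneg (sub_nonneg.2 h) hδpos.le,
      mul_nonneg (mul_nonneg (sub_nonneg.2 h) hδpos.le) (sub_nonneg.2 hB1_one.le),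
      mul_pos hρ (sub_pos.2 hB3_one)]
  have hgap : B1 < B3 + B4 - B3 * B4 := by
    have h : δ * (B1 - 1) < r := by
      by_contra! h
      nlinarith [mul_pos hla (sub_pos.2 hB1_one)]
    have : δ * B1 < δ * (B3 + B4 - B3 * B4) := by linarith
    exact lt_of_mul_lt_mul_left this hδpos.le
  have hone : -B3*(1 - B4)*(B1 - B3) - B4*(B3 - 1)*(B1 - B4) > 0 := by
    have : 0 < (B3 - B4) * (B3 + B4 - B3 * B4 - B1) :=
      mul_pos (by linarith) (by linarith)
    linarith
  refine ⟨?_, hone⟩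
  rintro z ⟨hz, hz_le⟩
  have hpow : z ^ (B3 - 1) ≤ z ^ (B4 - 1) :=
    Real.rpow_le_rpow_of_exponent_ge hz hz_le (by linarith)
  have hcoef : 0 ≤ -B4 * (B3 - 1) * (B1 - B4) :=
    mul_nonneg (mul_nonneg (by linarith) (by linarith)) (by linarith)
  have := mul_pos hone (Real.rpow_pos_of_pos hz (B3 - 1))
  linarith [mul_le_mul_of_nonneg_left hpow hcoef]
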